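/- Let R be a G-graded domain. Then R is a graded perinormal domain if and only if every graded overring of R that satisfies graded going-down (gGD) is flat as an R-module. -/

import Mathlib

/-! Core definitions for graded perinormality, following Epstein–Shapiro style graded notions. -/

section Core

variable {ι : Type*} [DecidableEq ι] [AddCommMonoid ι]
variable {R : Type*} [CommRing R]

/-- `𝒜` is a grading of the ring `R` by the (torsionless) monoid `ι`:
the components multiply correctly and give an internal direct sum decomposition. -/
structure IsGrRing (𝒜 : ι → AddSubgroup R) : Prop where
  one_mem : (1 : R) ∈ 𝒜 0
  mul_mem : ∀ {i j : ι} {a b : R}, a ∈ 𝒜 i → b ∈ 𝒜 j → a * b ∈ 𝒜 (i + j)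
  internal : DirectSum.IsInternal 𝒜

/-- An ideal of `R` is homogeneous iff every element of it is a finite sum of
homogeneous elements of the ideal. -/
def IsHomIdeal (𝒜 : ι → AddSubgroup R) (I : Ideal R) : Prop :=
  ∀ x ∈ I, x ∈ AddSubmonoid.closure {y : R | SetLike.IsHomogeneousElem 𝒜 y ∧ y ∈ I}

/-- A graded (homogeneous) maximal ideal: maximal among proper homogeneous ideals. -/
def IsGrMaxIdeal (𝒜 : ι → AddSubgroup R) (I : Ideal R) : Prop :=
  IsHomIdeal 𝒜 I ∧ I ≠ ⊤ ∧ ∀ J : Ideal R, IsHomIdeal 𝒜 J → I ≤ J → J ≠ ⊤ → J = I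

/-- `R` is gr-local: it has exactly one graded maximal ideal. -/
def GrLocal (𝒜 : ι → AddSubgroup R) : Prop :=
  ∃! I : Ideal R, IsGrMaxIdeal 𝒜 I

/-- A prime ideal of height one (in a domain). -/
def HeightOnePrime (P : Ideal R) : Prop :=
  P.IsPrime ∧ P ≠ ⊥ ∧ ∀ Q : Ideal R, Q.IsPrime → Q < P → Q = ⊥

variable [IsDomain R]

/-- A homogeneous element of the graded quotient field of `R`, i.e. a quotient of two
homogeneous elements of `R` (viewed inside the full quotient field). -/
def IsHomFrac (𝒜 : ι → AddSubgroup R) (x : FractionRing R) : Prop :=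
  ∃ (i j : ι) (a b : R), a ∈ 𝒜 i ∧ b ∈ 𝒜 j ∧ b ≠ 0 ∧
    x * algebraMap R (FractionRing R) b = algebraMap R (FractionRing R) a

/-- `S` is a graded overring of `R`: a ring between `R` and the graded quotient field that is
the sum of its homogeneous components, i.e. each of its elements is a finite sum of
homogeneous elements of `S`. -/
def IsGradedOverring (𝒜 : ι → AddSubgroup R) (S : Subalgebra R (FractionRing R)) : Prop :=
  ∀ x ∈ S, x ∈ AddSubmonoid.closure {y : FractionRing R | y ∈ S ∧ IsHomFrac 𝒜 y}

/-- A homogeneous ideal of an overring `S` of `R`. -/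
def IsHomIdealOver (𝒜 : ι → AddSubgroup R) (S : Subalgebra R (FractionRing R))
    (I : Ideal S) : Prop :=
  ∀ x ∈ I, (x : FractionRing R) ∈ AddSubmonoid.closure
    {y : FractionRing R | IsHomFrac 𝒜 y ∧ ∃ h : y ∈ S, (⟨y, h⟩ : S) ∈ I}

/-- A graded maximal ideal of an overring. -/
def IsGrMaxIdealOver (𝒜 : ι → AddSubgroup R) (S : Subalgebra R (FractionRing R))
    (I : Ideal S) : Prop :=
  IsHomIdealOver 𝒜 S I ∧ I ≠ ⊤ ∧
    ∀ J : Ideal S, IsHomIdealOver 𝒜 S J → I ≤ J → J ≠ ⊤ → J = I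

/-- The overring `S` is gr-local. -/
def GrLocalOver (𝒜 : ι → AddSubgroup R) (S : Subalgebra R (FractionRing R)) : Prop :=
  ∃! I : Ideal S, IsGrMaxIdealOver 𝒜 S I

/-- `S` satisfies graded going-down (gGD) over `R`. -/
def GGD (𝒜 : ι → AddSubgroup R) (S : Subalgebra R (FractionRing R)) : Prop :=
  ∀ (P Q : Ideal R) (Qt : Ideal S), P.IsPrime → Q.IsPrime → Qt.IsPrime →
    IsHomIdeal 𝒜 P → IsHomIdeal 𝒜 Q → IsHomIdealOver 𝒜 S Qt → P ≤ Q →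
    Qt.comap (algebraMap R S) = Q →
    ∃ Pt : Ideal S, Pt.IsPrime ∧ IsHomIdealOver 𝒜 S Pt ∧ Pt ≤ Qt ∧
      Pt.comap (algebraMap R S) = P

/-- The overring `S` is a localization of `R` (at some multiplicative subset `W` of `R`). -/
def IsLocalizationOfR (S : Subalgebra R (FractionRing R)) : Prop :=
  ∃ W : Submonoid R, (∀ w ∈ W, IsUnit (algebraMap R S w)) ∧
    ∀ s : S, ∃ (r w : R), w ∈ W ∧ s * algebraMap R S w = algebraMap R S r

/-- `R` is a graded perinormal domain: every gr-local graded overring satisfying gGD is a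
localization of `R`. -/
def GradedPerinormal (𝒜 : ι → AddSubgroup R) : Prop :=
  ∀ S : Subalgebra R (FractionRing R),
    IsGradedOverring 𝒜 S → GrLocalOver 𝒜 S → GGD 𝒜 S → IsLocalizationOfR S

/-- `R` is a graded globally perinormal domain: every graded overring satisfying gGD is a
localization of `R`. -/
def GradedGloballyPerinormal (𝒜 : ι → AddSubgroup R) : Prop :=
  ∀ S : Subalgebra R (FractionRing R),
    IsGradedOverring 𝒜 S → GGD 𝒜 S → IsLocalizationOfR S

/-- The homogeneous localization `R_(P)` of `R` at an ideal `P`: the subring of the graded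
quotient field consisting of fractions with homogeneous denominator outside `P`. -/
def HomLocR (𝒜 : ι → AddSubgroup R) (P : Ideal R) : Subalgebra R (FractionRing R) :=
  Algebra.adjoin R {x : FractionRing R | ∃ a w : R, SetLike.IsHomogeneousElem 𝒜 w ∧ w ∉ P ∧
    x * algebraMap R (FractionRing R) w = algebraMap R (FractionRing R) a}

/-- The homogeneous localization `S_(Q)` of an overring `S` at an ideal `Q` of `S`. -/
def HomLocOver (𝒜 : ι → AddSubgroup R) (S : Subalgebra R (FractionRing R)) (Q : Ideal S) :
    Subalgebra R (FractionRing R) :=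
  Algebra.adjoin R {x : FractionRing R | ∃ s w : S, IsHomFrac 𝒜 (w : FractionRing R) ∧
    w ∉ Q ∧ x * (w : FractionRing R) = (s : FractionRing R)}

/-- The localization `R_W` of `R` at a multiplicative set `W`, as a subring of the quotient
field. -/
def LocW (W : Submonoid R) : Subalgebra R (FractionRing R) :=
  Algebra.adjoin R {x : FractionRing R | ∃ r : R, ∃ w ∈ W,
    x * algebraMap R (FractionRing R) w = algebraMap R (FractionRing R) r}

/-- A subring `V` of the graded quotient field (containing `R`) is a gr-valuation domain:
for every nonzero homogeneous `x` of the graded quotient field, `x ∈ V` or `x⁻¹ ∈ V`. -/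
def GrValuation (𝒜 : ι → AddSubgroup R) (V : Subalgebra R (FractionRing R)) : Prop :=
  ∀ x : FractionRing R, x ≠ 0 → IsHomFrac 𝒜 x → x ∈ V ∨ x⁻¹ ∈ V

/-- `R` is a gr-(R₁) domain: the homogeneous localization at every height-one homogeneous
prime is a gr-valuation domain. -/
def GrR1 (𝒜 : ι → AddSubgroup R) : Prop :=
  ∀ P : Ideal R, HeightOnePrime P → IsHomIdeal 𝒜 P → GrValuation 𝒜 (HomLocR 𝒜 P)

/-- The ideal `I` of `T` is the contraction of the ideal `J` of `S` (that is, `I = J ∩ T`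
inside the common quotient field). -/
def Contracts (T S : Subalgebra R (FractionRing R)) (J : Ideal S) (I : Ideal T) : Prop :=
  ∀ x : FractionRing R,
    (∃ h : x ∈ T, (⟨x, h⟩ : T) ∈ I) ↔ (x ∈ T ∧ ∃ h : x ∈ S, (⟨x, h⟩ : S) ∈ J)

/-- `S` satisfies graded going-down over the intermediate ring `T`. -/
def GGDSub (𝒜 : ι → AddSubgroup R) (T S : Subalgebra R (FractionRing R)) : Prop :=
  ∀ (P Q : Ideal T) (Qt : Ideal S), P.IsPrime → Q.IsPrime → Qt.IsPrime →
    IsHomIdealOver 𝒜 T P → IsHomIdealOver 𝒜 T Q → IsHomIdealOver 𝒜 S Qt → P ≤ Q →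
    Contracts T S Qt Q →
    ∃ Pt : Ideal S, Pt.IsPrime ∧ IsHomIdealOver 𝒜 S Pt ∧ Pt ≤ Qt ∧ Contracts T S Pt P

/-- `S` is a localization of the intermediate ring `T` at a multiplicative subset of `T`. -/
def IsLocalizationOfSub (T S : Subalgebra R (FractionRing R)) : Prop :=
  ∃ W : Submonoid (FractionRing R), (W : Set (FractionRing R)) ⊆ T ∧
    (∀ w ∈ W, ∃ y ∈ S, w * y = 1) ∧ ∀ s ∈ S, ∃ t ∈ T, ∃ w ∈ W, s * w = t

/-- The intermediate ring `T` (e.g. a homogeneous localization of `R`) is a graded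
perinormal domain. -/
def GradedPerinormalSub (𝒜 : ι → AddSubgroup R) (T : Subalgebra R (FractionRing R)) : Prop :=
  ∀ S : Subalgebra R (FractionRing R), T ≤ S → IsGradedOverring 𝒜 S → GrLocalOver 𝒜 S →
    GGDSub 𝒜 T S → IsLocalizationOfSub T S

/-- The intermediate ring `T` is a graded globally perinormal domain. -/
def GradedGloballyPerinormalSub (𝒜 : ι → AddSubgroup R)
    (T : Subalgebra R (FractionRing R)) : Prop :=
  ∀ S : Subalgebra R (FractionRing R), T ≤ S → IsGradedOverring 𝒜 S →
    GGDSub 𝒜 T S → IsLocalizationOfSub T S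

/-- `R` is a gr-essential domain: `R` is the intersection of homogeneous localizations at a
family of homogeneous primes, each of which is a gr-valuation domain. -/
def GrEssential (𝒜 : ι → AddSubgroup R) : Prop :=
  ∃ I : Set (Ideal R),
    (∀ P ∈ I, P.IsPrime ∧ IsHomIdeal 𝒜 P ∧ GrValuation 𝒜 (HomLocR 𝒜 P)) ∧
    ((⊥ : Subalgebra R (FractionRing R)) : Set (FractionRing R)) =
      ⋂ P ∈ I, (HomLocR 𝒜 P : Set (FractionRing R))

/-- The intermediate ring `T` is a gr-essential domain. -/
def GrEssentialSub (𝒜 : ι → AddSubgroup R) (T : Subalgebra R (FractionRing R)) : Prop :=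
  ∃ I : Set (Ideal T),
    (∀ P ∈ I, P.IsPrime ∧ IsHomIdealOver 𝒜 T P ∧ GrValuation 𝒜 (HomLocOver 𝒜 T P)) ∧
    (T : Set (FractionRing R)) = ⋂ P ∈ I, (HomLocOver 𝒜 T P : Set (FractionRing R))

end Core

set_option linter.unusedSectionVars false

theorem AddSubmonoid.mul_mem_closure {A : Type*} [Semiring A] {s t u : Set A}
    (h : ∀ x ∈ s, ∀ y ∈ t, x * y ∈ u) {x y : A} (hx : x ∈ AddSubmonoid.closure s)
    (hy : y ∈ AddSubmonoid.closure t) : x * y ∈ AddSubmonoid.closure u := by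
  have := AddSubmonoid.mul_mem_mul hx hy
  rw [AddSubmonoid.closure_mul_closure] at this
  exact AddSubmonoid.closure_mono (Set.mul_subset_iff.2 h) this

section HomogeneousFractions

variable {G : Type*} [DecidableEq G] [AddCommGroup G]
variable {R : Type*} [CommRing R] [IsDomain R] {𝒜 : G → AddSubgroup R}

local notation "K" => FractionRing R

/-- The graded ring structure carried by an internal grading. -/
@[reducible] noncomputable def IsGrRing.gradedRing (h : IsGrRing 𝒜) : GradedRing 𝒜 :=
  letI := h.internal.chooseDecomposition
  { one_mem := h.one_mem
    mul_mem := fun _ _ _ _ ha hb => h.mul_mem ha hb }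

theorem FractionRing.algebraMap_ne_zero {b : R} (hb : b ≠ 0) : algebraMap R K b ≠ 0 :=
  (map_ne_zero_iff _ (IsFractionRing.injective R K)).2 hb

theorem IsHomFrac.inv {x : K} (hx : IsHomFrac 𝒜 x) (hx0 : x ≠ 0) : IsHomFrac 𝒜 x⁻¹ := by
  obtain ⟨i, j, a, b, ha, hb, hb0, h⟩ := hx
  refine ⟨j, i, b, a, hb, ha, ?_, ?_⟩
  · rintro rfl
    exact mul_ne_zero hx0 (FractionRing.algebraMap_ne_zero hb0) (by simpa using h)
  · rw [← h, inv_mul_cancel_left₀ hx0]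

/-- A proper homogeneous ideal of an overring is contained in a graded maximal ideal. -/
theorem exists_le_isGrMaxIdealOver {S : Subalgebra R K} {I : Ideal S}
    (hI : IsHomIdealOver 𝒜 S I) (hI1 : I ≠ ⊤) : ∃ M, IsGrMaxIdealOver 𝒜 S M ∧ I ≤ M := by
  obtain ⟨M, hIM, hM⟩ := zorn_le_nonempty₀ {J : Ideal S | IsHomIdealOver 𝒜 S J ∧ J ≠ ⊤}
    (fun c hc hchain J hJ => by
      have hdir : DirectedOn (· ≤ ·) c := hchain.directedOn
      refine ⟨sSup c, ⟨fun x hx => ?_, fun htop => ?_⟩, fun _ => le_sSup⟩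
      · obtain ⟨L, hL, hxL⟩ := (Submodule.mem_sSup_of_directed ⟨J, hJ⟩ hdir).1 hx
        refine AddSubmonoid.closure_mono ?_ ((hc hL).1 x hxL)
        rintro y ⟨hy, hyS, hyL⟩
        exact ⟨hy, hyS, le_sSup hL hyL⟩
      · obtain ⟨L, hL, h1⟩ := (Submodule.mem_sSup_of_directed ⟨J, hJ⟩ hdir).1
          ((Ideal.eq_top_iff_one _).1 htop)
        exact (hc hL).2 ((Ideal.eq_top_iff_one _).2 h1)) I ⟨hI, hI1⟩
  exact ⟨M, ⟨hM.prop.1, hM.prop.2, fun J hJ hMJ hJ1 => le_antisymm (hM.2 ⟨hJ, hJ1⟩ hMJ) hMJ⟩, hIM⟩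

variable [GradedRing 𝒜]

theorem IsHomFrac.of_mem {i : G} {a : R} (ha : a ∈ 𝒜 i) : IsHomFrac 𝒜 (algebraMap R K a) :=
  ⟨i, 0, a, 1, ha, SetLike.GradedOne.one_mem, one_ne_zero, by simp⟩

theorem IsHomFrac.one : IsHomFrac 𝒜 (1 : K) := by
  simpa using IsHomFrac.of_mem (SetLike.GradedOne.one_mem (A := 𝒜))

theorem IsHomFrac.mul {x y : K} (hx : IsHomFrac 𝒜 x) (hy : IsHomFrac 𝒜 y) :
    IsHomFrac 𝒜 (x * y) := by
  obtain ⟨i, j, a, b, ha, hb, hb0, h⟩ := hx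
  obtain ⟨i', j', a', b', ha', hb', hb0', h'⟩ := hy
  refine ⟨i + i', j + j', a * a', b * b', SetLike.GradedMul.mul_mem ha ha',
    SetLike.GradedMul.mul_mem hb hb', mul_ne_zero hb0 hb0', ?_⟩
  rw [map_mul, map_mul, ← h, ← h']
  ring

/-- Multiplication by a homogeneous element of degree `e` shifts homogeneous components. -/
theorem decompose_mul_shift {e : G} {d : R} (hd : d ∈ 𝒜 e) (r : R) (k : G) :
    (DirectSum.decompose 𝒜 (d * r) k : R) = d * DirectSum.decompose 𝒜 r (k - e) := by
  have := DirectSum.coe_decompose_mul_add_of_left_mem 𝒜 (j := k - e) (b := r) hd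
  rwa [add_sub_cancel] at this

/-- If a homogeneous fraction `x` is multiplied into `R` by `r`, then so it is by the homogeneous
components of `r`. -/
theorem IsHomFrac.colon_homogeneous {x : K} (hx : IsHomFrac 𝒜 x) {r s : R}
    (h : algebraMap R K r * x = algebraMap R K s) (k : G) :
    ∃ t : R, algebraMap R K (DirectSum.decompose 𝒜 r k) * x = algebraMap R K t := by
  obtain ⟨i, j, a, b, ha, hb, hb0, hab⟩ := hx
  have hrs : a * r = b * s := by
    apply IsFractionRing.injective R K
    rw [map_mul, map_mul, ← h, ← hab]
    ring
  have key : a * (DirectSum.decompose 𝒜 r k : R) = b * DirectSum.decompose 𝒜 s (i + k - j) := by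
    rw [← decompose_mul_shift hb, ← hrs, decompose_mul_shift ha, add_sub_cancel_left]
  refine ⟨DirectSum.decompose 𝒜 s (i + k - j), ?_⟩
  apply mul_right_cancel₀ (FractionRing.algebraMap_ne_zero hb0)
  rw [mul_assoc, hab, ← map_mul, ← map_mul, mul_comm, key, mul_comm]

/-- A sum of homogeneous fractions lying in `A` has a homogeneous denominator for which all
homogeneous components of the fraction lie in `A`. -/
theorem exists_homogeneous_denominator (A : AddSubmonoid K) {x : K}
    (hx : x ∈ AddSubmonoid.closure {y : K | IsHomFrac 𝒜 y ∧ y ∈ A}) :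
    ∃ (e : G) (d r : R), d ∈ 𝒜 e ∧ d ≠ 0 ∧ algebraMap R K d * x = algebraMap R K r ∧
      ∀ k, algebraMap R K (DirectSum.decompose 𝒜 r k) / algebraMap R K d ∈ A := by
  induction hx using AddSubmonoid.closure_induction with
  | mem x hx =>
    obtain ⟨⟨i, j, a, b, ha, hb, hb0, h⟩, hxA⟩ := hx
    refine ⟨j, b, a, hb, hb0, by rw [mul_comm, h], fun k => ?_⟩
    by_cases hk : i = k
    · subst hk
      rw [DirectSum.decompose_of_mem_same _ ha, ← h,
        mul_div_cancel_right₀ _ (FractionRing.algebraMap_ne_zero hb0)]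
      exact hxA
    · rw [DirectSum.decompose_of_mem_ne _ ha hk]
      simp
  | zero => exact ⟨0, 1, 0, SetLike.GradedOne.one_mem, one_ne_zero, by simp, by simp⟩
  | add x y _ _ ihx ihy =>
    obtain ⟨e, d, r, hd, hd0, h, hA⟩ := ihx
    obtain ⟨e', d', r', hd', hd0', h', hA'⟩ := ihy
    refine ⟨e + e', d * d', d' * r + d * r', SetLike.GradedMul.mul_mem hd hd',
      mul_ne_zero hd0 hd0', ?_, fun k => ?_⟩
    · simp only [map_mul, map_add, ← h, ← h']
      ring
    · have h0 := FractionRing.algebraMap_ne_zero hd0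
      have h0' := FractionRing.algebraMap_ne_zero hd0'
      rw [DirectSum.decompose_add, DirectSum.add_apply, AddSubgroup.coe_add,
        decompose_mul_shift hd', decompose_mul_shift hd]
      convert A.add_mem (hA (k - e')) (hA' (k - e)) using 1
      simp only [map_mul, map_add]
      field_simp

/-- An element that is a sum of homogeneous fractions in `A` and also such a sum in `B` is a sum
of homogeneous fractions in `A ⊓ B`. -/
theorem mem_closure_homFrac_inf {A B : AddSubmonoid K} {x : K}
    (hA : x ∈ AddSubmonoid.closure {y : K | IsHomFrac 𝒜 y ∧ y ∈ A})
    (hB : x ∈ AddSubmonoid.closure {y : K | IsHomFrac 𝒜 y ∧ y ∈ B}) :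
    x ∈ AddSubmonoid.closure {y : K | IsHomFrac 𝒜 y ∧ y ∈ A ⊓ B} := by
  obtain ⟨e, d, r, hd, hd0, h, hrA⟩ := exists_homogeneous_denominator A hA
  obtain ⟨e', d', r', hd', hd0', h', hrB⟩ := exists_homogeneous_denominator B hB
  have h0 := FractionRing.algebraMap_ne_zero hd0
  have h0' := FractionRing.algebraMap_ne_zero hd0'
  have hrr : d' * r = d * r' := by
    apply IsFractionRing.injective R K
    rw [map_mul, map_mul, ← h, ← h']
    ring
  classical
  have hx : x = ∑ k ∈ (DirectSum.decompose 𝒜 r).support,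
      algebraMap R K (DirectSum.decompose 𝒜 r k) / algebraMap R K d := by
    rw [← Finset.sum_div, ← map_sum, DirectSum.sum_support_decompose, ← h,
      mul_div_cancel_left₀ _ h0]
  rw [hx]
  refine AddSubmonoid.sum_mem _ fun k _ => AddSubmonoid.subset_closure
    ⟨⟨k, e, _, d, SetLike.coe_mem _, hd, hd0, div_mul_cancel₀ _ h0⟩, hrA k, ?_⟩
  have hk : algebraMap R K (DirectSum.decompose 𝒜 r k) / algebraMap R K d =
      algebraMap R K (DirectSum.decompose 𝒜 r' (k + e' - e)) / algebraMap R K d' := by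
    rw [div_eq_div_iff h0 h0', ← map_mul, ← map_mul, mul_comm, mul_comm _ d,
      ← decompose_mul_shift hd, ← hrr, decompose_mul_shift hd', add_sub_cancel_right]
  rw [hk]
  exact hrB _

/-- An ideal of an overring spanned by homogeneous elements is homogeneous. -/
theorem isHomIdealOver_span {S : Subalgebra R K} (hS : IsGradedOverring 𝒜 S) {A : Set S}
    (hA : ∀ a ∈ A, IsHomFrac 𝒜 (a : K)) : IsHomIdealOver 𝒜 S (Ideal.span A) := by
  intro x hx
  induction hx using Submodule.span_induction with
  | mem x hx => exact AddSubmonoid.subset_closure ⟨hA x hx, x.2, Ideal.subset_span hx⟩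
  | zero => exact zero_mem _
  | add x y _ _ ihx ihy => exact add_mem ihx ihy
  | smul s x _ ih =>
    rw [smul_eq_mul, MulMemClass.coe_mul]
    refine AddSubmonoid.mul_mem_closure ?_ (hS s s.2) ih
    rintro s ⟨hsS, hs⟩ x ⟨hx, hxS, hxI⟩
    exact ⟨hs.mul hx, mul_mem hsS hxS, Ideal.mul_mem_left _ ⟨s, hsS⟩ hxI⟩

/-- Homogeneous elements outside a graded maximal ideal are closed under multiplication. -/
theorem IsGrMaxIdealOver.mul_notMem {S : Subalgebra R K} (hS : IsGradedOverring 𝒜 S)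
    {M : Ideal S} (hM : IsGrMaxIdealOver 𝒜 S M) {v w : S} (hvh : IsHomFrac 𝒜 (v : K))
    (hv : v ∉ M) (hw : w ∉ M) : v * w ∉ M := by
  intro hvw
  have hle : M ≤ M ⊔ Ideal.span {v} := le_sup_left
  have hhom : IsHomIdealOver 𝒜 S (M ⊔ Ideal.span {v}) := by
    intro x hx
    obtain ⟨m, hm, n, hn, rfl⟩ := Submodule.mem_sup.1 hx
    have hspan := isHomIdealOver_span hS (A := {v}) (by rintro _ rfl; exact hvh)
    refine add_mem (AddSubmonoid.closure_mono ?_ (hM.1 m hm))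
      (AddSubmonoid.closure_mono ?_ (hspan n hn))
    · rintro y ⟨hy, hyS, hyM⟩
      exact ⟨hy, hyS, hle hyM⟩
    · rintro y ⟨hy, hyS, hyM⟩
      exact ⟨hy, hyS, (le_sup_right : _ ≤ M ⊔ Ideal.span {v}) hyM⟩
  have htop : M ⊔ Ideal.span {v} = ⊤ := by
    by_contra hne
    apply hv
    rw [← hM.2.2 _ hhom hle hne]
    exact Ideal.mem_sup_right (Ideal.mem_span_singleton_self v)
  obtain ⟨m, hm, n, hn, hmn⟩ := Submodule.mem_sup.1 ((Ideal.eq_top_iff_one _).1 htop)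
  obtain ⟨t, rfl⟩ := Ideal.mem_span_singleton'.1 hn
  apply hw
  have : w = w * m + t * (v * w) := by linear_combination (-w) * hmn
  rw [this]
  exact add_mem (Ideal.mul_mem_left _ _ hm) (Ideal.mul_mem_left _ _ hvw)

/-- The homogeneous elements of an overring outside a graded maximal ideal. -/
def IsGrMaxIdealOver.units {S : Subalgebra R K} (hS : IsGradedOverring 𝒜 S)
    {M : Ideal S} (hM : IsGrMaxIdealOver 𝒜 S M) : Submonoid S where
  carrier := {w | IsHomFrac 𝒜 (w : K) ∧ w ∉ M}
  one_mem' := ⟨IsHomFrac.one, fun h => hM.2.1 ((Ideal.eq_top_iff_one _).2 h)⟩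
  mul_mem' := fun ha hb => ⟨ha.1.mul hb.1, hM.mul_notMem hS ha.1 ha.2 hb.2⟩

end HomogeneousFractions

section Fractions

variable {R : Type*} [CommRing R] [IsDomain R]

local notation "K" => FractionRing R

/-- The fractions with numerator in the overring `S` and denominator in `U`. -/
def Subalgebra.fractions (S : Subalgebra R K) (U : Submonoid S) : Subalgebra R K where
  carrier := {x | ∃ u ∈ U, x * (u : K) ∈ S}
  mul_mem' := by
    rintro x y ⟨u, hu, hx⟩ ⟨v, hv, hy⟩
    refine ⟨u * v, mul_mem hu hv, ?_⟩
    convert mul_mem hx hy using 1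
    push_cast
    ring
  add_mem' := by
    rintro x y ⟨u, hu, hx⟩ ⟨v, hv, hy⟩
    refine ⟨u * v, mul_mem hu hv, ?_⟩
    convert add_mem (mul_mem hx v.2) (mul_mem hy u.2) using 1
    push_cast
    ring
  algebraMap_mem' := fun r => ⟨1, one_mem U, by simp⟩

theorem Subalgebra.le_fractions (S : Subalgebra R K) (U : Submonoid S) : S ≤ S.fractions U :=
  fun x hx => ⟨1, one_mem U, by simpa using hx⟩

/-- The extension of an ideal of an overring to a ring of fractions. -/
def Ideal.fractions {S : Subalgebra R K} (U : Submonoid S) (I : Ideal S) :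
    Ideal (S.fractions U) where
  carrier := {x | ∃ u ∈ U, ∃ s ∈ I, (x : K) * u = s}
  zero_mem' := ⟨1, one_mem U, 0, zero_mem I, by simp⟩
  add_mem' := by
    rintro x y ⟨u, hu, s, hs, hx⟩ ⟨v, hv, t, ht, hy⟩
    refine ⟨u * v, mul_mem hu hv, v * s + u * t,
      add_mem (Ideal.mul_mem_left _ _ hs) (Ideal.mul_mem_left _ _ ht), ?_⟩
    push_cast
    linear_combination (v : K) * hx + (u : K) * hy
  smul_mem' := by
    rintro ⟨x, v, hv, hx⟩ y ⟨u, hu, s, hs, hy⟩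
    refine ⟨v * u, mul_mem hv hu, ⟨_, hx⟩ * s, Ideal.mul_mem_left _ _ hs, ?_⟩
    rw [smul_eq_mul]
    push_cast
    linear_combination x * v * hy

end Fractions

section Denominators

variable {R : Type*} [CommRing R] [IsDomain R]

local notation "K" => FractionRing R

/-- The ideal of denominators of a fraction. -/
def FractionRing.denominators (x : K) : Ideal R where
  carrier := {r | ∃ t, algebraMap R K r * x = algebraMap R K t}
  zero_mem' := ⟨0, by simp⟩
  add_mem' := by
    rintro r s ⟨t, ht⟩ ⟨u, hu⟩
    exact ⟨t + u, by rw [map_add, map_add, add_mul, ht, hu]⟩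
  smul_mem' := by
    rintro c r ⟨t, ht⟩
    exact ⟨c * t, by rw [smul_eq_mul, map_mul, map_mul, mul_assoc, ht]⟩

open FractionRing

theorem FractionRing.denominators_mul_le_add (x y : K) :
    denominators x * denominators y ≤ denominators (x + y) := by
  rw [Ideal.mul_le]
  rintro r ⟨t, ht⟩ s ⟨u, hu⟩
  refine ⟨s * t + r * u, ?_⟩
  simp only [map_mul, map_add, ← ht, ← hu]
  ring

/-- Over a flat overring `S`, the denominator ideal of each element of `S` extends to `S`. -/
theorem map_denominators_of_flat (S : Subalgebra R K) [Module.Flat R S] (x : S) :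
    (denominators (x : K)).map (algebraMap R S) = ⊤ := by
  obtain ⟨a, b, hb, hab⟩ := IsFractionRing.div_surjective (A := R) (x : K)
  have hb0 : algebraMap R K b ≠ 0 := algebraMap_ne_zero (nonZeroDivisors.ne_zero hb)
  have hrel : ∑ i, (![b, -a] i) • (![x, 1] i : S) = 0 := by
    apply Subtype.ext
    simp only [Fin.sum_univ_two, Matrix.cons_val_zero, Matrix.cons_val_one]
    push_cast
    rw [Algebra.smul_def, Algebra.smul_def, ← hab, map_neg]
    field_simp
    simp
  obtain ⟨k, c, y, hy, hc⟩ := Module.Flat.isTrivialRelation_of_sum_smul_eq_zero hrel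
  rw [Ideal.eq_top_iff_one]
  have h1 : (1 : S) = ∑ j, c 1 j • y j := hy 1
  rw [h1]
  refine Ideal.sum_mem _ fun j _ => ?_
  rw [Algebra.smul_def]
  refine Ideal.mul_mem_right _ _ (Ideal.mem_map_of_mem _ ⟨c 0 j, ?_⟩)
  have hj := congrArg (algebraMap R K) (hc j)
  simp only [Fin.sum_univ_two, Matrix.cons_val_zero, Matrix.cons_val_one, map_add, map_mul,
    map_neg, map_zero] at hj
  rw [← hab]
  field_simp
  linear_combination -hj

/-- An overring all of whose elements have denominator ideal extending to the unit ideal is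
flat. -/
theorem flat_of_map_denominators (S : Subalgebra R K)
    (h : ∀ x : S, (denominators (x : K)).map (algebraMap R S) = ⊤) : Module.Flat R S := by
  refine Module.Flat.of_forall_isTrivialRelation fun {l f x} hfx => ?_
  have hprod : (∏ i, denominators (x i : K)).map (algebraMap R S) = ⊤ := by
    have := map_prod (Ideal.mapHom (algebraMap R S)) (fun i => denominators (x i : K)) Finset.univ
    rw [← Ideal.one_eq_top]
    refine this.trans (Finset.prod_eq_one fun i _ => ?_)
    rw [Ideal.one_eq_top]
    exact h (x i)
  obtain ⟨n, y, g, hg⟩ := Submodule.mem_span_set'.1 ((Ideal.eq_top_iff_one _).1 hprod)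
  choose r hr hrg using fun j => (g j).2
  have hden : ∀ i j, ∃ t, algebraMap R K (r j) * (x i : K) = algebraMap R K t := fun i j =>
    (Ideal.prod_le_inf.trans (Finset.inf_le (Finset.mem_univ i)) (hr j) :
      r j ∈ denominators (x i : K))
  choose a ha using hden
  have hg' : ∑ j, algebraMap R K (r j) * (y j : K) = 1 := by
    have := congrArg (Subtype.val : S → K) hg
    simpa [← hrg, mul_comm] using this
  refine ⟨n, a, y, fun i => Subtype.ext ?_, fun j => ?_⟩
  · push_cast
    simp only [Algebra.smul_def, ← ha]
    calc (x i : K) = (x i : K) * ∑ j, algebraMap R K (r j) * (y j : K) := by rw [hg', mul_one]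
      _ = _ := by
        rw [Finset.mul_sum]
        exact Finset.sum_congr rfl fun j _ => by ring
  · apply IsFractionRing.injective R K
    have := congrArg (Subtype.val : S → K) hfx
    push_cast at this
    simp only [Algebra.smul_def] at this
    rw [map_zero, map_sum]
    simp only [map_mul, ← ha]
    calc _ = algebraMap R K (r j) * ∑ i, algebraMap R K (f i) * (x i : K) := by
          rw [Finset.mul_sum]
          exact Finset.sum_congr rfl fun i _ => by ring
      _ = 0 := by rw [this, mul_zero]

end Denominators

section GradedOverrings

open FractionRing

variable {G : Type*} [DecidableEq G] [AddCommGroup G]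
variable {R : Type*} [CommRing R] [IsDomain R] {𝒜 : G → AddSubgroup R} [GradedRing 𝒜]
variable {S : Subalgebra R (FractionRing R)} {U : Submonoid S}

local notation "K" => FractionRing R

/-- The extended denominator ideal of a homogeneous fraction is generated by homogeneous
denominators. -/
theorem IsHomFrac.map_denominators {x : K} (hx : IsHomFrac 𝒜 x) (S : Subalgebra R K) :
    (denominators x).map (algebraMap R S) =
      Ideal.span {a : S | IsHomFrac 𝒜 (a : K) ∧ ∃ r ∈ denominators x, algebraMap R S r = a} := by
  classical
  apply le_antisymm
  · rw [Ideal.map_le_iff_le_comap]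
    rintro r ⟨t, ht⟩
    rw [Ideal.mem_comap, ← DirectSum.sum_support_decompose 𝒜 r, map_sum]
    refine Ideal.sum_mem _ fun k _ => Ideal.subset_span ⟨?_, _, hx.colon_homogeneous ht k, rfl⟩
    exact IsHomFrac.of_mem (SetLike.coe_mem _)
  · rw [Ideal.span_le]
    rintro _ ⟨-, r, hr, rfl⟩
    exact Ideal.mem_map_of_mem _ hr

/-- A flat gr-local graded overring is a localization. -/
theorem isLocalizationOfR_of_flat (hS : IsGradedOverring 𝒜 S) (hloc : GrLocalOver 𝒜 S)
    [Module.Flat R S] : IsLocalizationOfR S := by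
  obtain ⟨M, hM, huniq⟩ := hloc
  have key : ∀ x ∈ S, ∃ w ∈ denominators x, IsUnit (algebraMap R S w) := by
    intro x hx
    replace hx := hS x hx
    induction hx using AddSubmonoid.closure_induction with
    | mem x hx =>
      by_contra! hcon
      have htop := map_denominators_of_flat S ⟨x, hx.1⟩
      rw [hx.2.map_denominators S] at htop
      apply hM.2.1
      rw [eq_top_iff, ← htop, Ideal.span_le]
      rintro _ ⟨hahom, r, hr, rfl⟩
      obtain ⟨N, hN, hle⟩ := exists_le_isGrMaxIdealOver
        (isHomIdealOver_span hS (A := {algebraMap R S r}) (by rintro _ rfl; exact hahom))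
        (mt Ideal.span_singleton_eq_top.1 (hcon r hr))
      rw [← huniq N hN]
      exact hle (Ideal.mem_span_singleton_self _)
    | zero => exact ⟨1, ⟨0, by simp⟩, by simp⟩
    | add x y _ _ ihx ihy =>
      obtain ⟨v, hv, hvu⟩ := ihx
      obtain ⟨w, hw, hwu⟩ := ihy
      exact ⟨v * w, denominators_mul_le_add x y (Ideal.mul_mem_mul hv hw), by
        rw [map_mul]; exact hvu.mul hwu⟩
  refine ⟨(IsUnit.submonoid S).comap (algebraMap R S), fun w hw => hw, fun s => ?_⟩
  obtain ⟨w, ⟨t, ht⟩, hwu⟩ := key s s.2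
  refine ⟨t, w, hwu, Subtype.ext ?_⟩
  rw [mul_comm]
  exact ht

theorem IsGradedOverring.fractions (hS : IsGradedOverring 𝒜 S)
    (hU : ∀ u ∈ U, IsHomFrac 𝒜 (u : K) ∧ (u : K) ≠ 0) : IsGradedOverring 𝒜 (S.fractions U) := by
  rintro x ⟨u, hu, hx⟩
  have hu0 := (hU u hu).2
  rw [← mul_inv_cancel_right₀ hu0 x]
  refine AddSubmonoid.mul_mem_closure ?_ (hS _ hx)
    (AddSubmonoid.subset_closure (Set.mem_singleton (u : K)⁻¹))
  rintro s ⟨hsS, hs⟩ _ rfl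
  exact ⟨⟨u, hu, by rwa [inv_mul_cancel_right₀ hu0]⟩, hs.mul ((hU u hu).1.inv hu0)⟩

theorem IsHomIdealOver.fractions {I : Ideal S} (hI : IsHomIdealOver 𝒜 S I)
    (hU : ∀ u ∈ U, IsHomFrac 𝒜 (u : K) ∧ (u : K) ≠ 0) :
    IsHomIdealOver 𝒜 (S.fractions U) (I.fractions U) := by
  rintro ⟨x, hxT⟩ ⟨u, hu, s, hs, hx⟩
  have hu0 := (hU u hu).2
  change x ∈ _
  change x * u = s at hx
  rw [← mul_inv_cancel_right₀ hu0 x, hx]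
  refine AddSubmonoid.mul_mem_closure ?_ (hI s hs)
    (AddSubmonoid.subset_closure (Set.mem_singleton (u : K)⁻¹))
  rintro t ⟨ht, htS, htI⟩ _ rfl
  have htu : t * (u : K)⁻¹ * u = t := inv_mul_cancel_right₀ hu0 t
  exact ⟨ht.mul ((hU u hu).1.inv hu0), ⟨u, hu, by rwa [htu]⟩, u, hu, ⟨t, htS⟩, htI, htu⟩

theorem Ideal.IsPrime.mem_of_mem_fractions {P : Ideal S} (hP : P.IsPrime)
    (hdisj : ∀ u ∈ U, u ∉ P) {s : S}
    (h : Subalgebra.inclusion (S.le_fractions U) s ∈ P.fractions U) : s ∈ P := by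
  obtain ⟨u, hu, t, ht, h⟩ := h
  have : s * u = t := Subtype.ext h
  exact (hP.mem_or_mem (this ▸ ht)).resolve_right (hdisj u hu)

theorem Ideal.IsPrime.fractions {P : Ideal S} (hP : P.IsPrime) (hdisj : ∀ u ∈ U, u ∉ P) :
    (P.fractions U).IsPrime := by
  refine ⟨fun htop => hP.ne_top ((Ideal.eq_top_iff_one _).2 ?_), ?_⟩
  · refine hP.mem_of_mem_fractions hdisj ?_
    rw [htop]
    trivial
  · rintro ⟨x, u, hu, hx⟩ ⟨y, v, hv, hy⟩ ⟨w, hw, p, hp, h⟩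
    change x * y * w = p at h
    have hmem : (⟨_, hx⟩ : S) * ⟨_, hy⟩ ∈ P := by
      refine (hP.mem_or_mem (y := w) ?_).resolve_right (hdisj w hw)
      have : (⟨_, hx⟩ : S) * ⟨_, hy⟩ * w = p * (u * v) := by
        apply Subtype.ext
        push_cast
        linear_combination (u : K) * v * h
      rw [this]
      exact Ideal.mul_mem_right _ _ hp
    exact (hP.mem_or_mem hmem).imp (fun h => ⟨u, hu, _, h, rfl⟩) (fun h => ⟨v, hv, _, h, rfl⟩)

/-- The contraction of a homogeneous ideal to a smaller graded overring is homogeneous. -/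
theorem IsHomIdealOver.comap_inclusion {T : Subalgebra R K} (hS : IsGradedOverring 𝒜 S)
    (hST : S ≤ T) {Q : Ideal T} (hQ : IsHomIdealOver 𝒜 T Q) :
    IsHomIdealOver 𝒜 S (Q.comap (Subalgebra.inclusion hST)) := by
  intro x hx
  let A : AddSubmonoid K := Q.toAddSubmonoid.map T.val
  have hA : (x : K) ∈ AddSubmonoid.closure {y : K | IsHomFrac 𝒜 y ∧ y ∈ A} := by
    refine AddSubmonoid.closure_mono ?_ (hQ _ hx)
    rintro y ⟨hy, hyT, hyQ⟩
    exact ⟨hy, ⟨y, hyT⟩, hyQ, rfl⟩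
  have hB : (x : K) ∈ AddSubmonoid.closure
      {y : K | IsHomFrac 𝒜 y ∧ y ∈ S.toSubsemiring.toAddSubmonoid} :=
    AddSubmonoid.closure_mono (fun _ hy => And.intro hy.2 hy.1) (hS x x.2)
  refine AddSubmonoid.closure_mono ?_ (mem_closure_homFrac_inf hA hB)
  rintro _ ⟨hy, ⟨q, hq, rfl⟩, hyS⟩
  exact ⟨hy, hyS, hq⟩

/-- Graded going-down passes to rings of fractions with homogeneous denominators. -/
theorem GGD.fractions (hgd : GGD 𝒜 S) (hS : IsGradedOverring 𝒜 S)
    (hU : ∀ u ∈ U, IsHomFrac 𝒜 (u : K) ∧ (u : K) ≠ 0) : GGD 𝒜 (S.fractions U) := by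
  intro P Q Qt hP hQ hQt hPh hQh hQth hPQ hcomap
  have hle := S.le_fractions U
  have hprime : (Qt.comap (Subalgebra.inclusion hle)).IsPrime := hQt.comap _
  obtain ⟨Pt, hPt, hPth, hPtle, hPtc⟩ := hgd P Q (Qt.comap (Subalgebra.inclusion hle)) hP hQ
    hprime hPh hQh (hQth.comap_inclusion hS hle) hPQ (by rw [← hcomap]; rfl)
  have hunit : ∀ u ∈ U, ∃ v : S.fractions U, v * Subalgebra.inclusion hle u = 1 := fun u hu =>
    ⟨⟨(u : K)⁻¹, u, hu, by rw [inv_mul_cancel₀ (hU u hu).2]; exact one_mem S⟩,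
      Subtype.ext (inv_mul_cancel₀ (hU u hu).2)⟩
  have hdisj : ∀ u ∈ U, u ∉ Pt := by
    intro u hu huP
    obtain ⟨v, hv⟩ := hunit u hu
    exact hQt.ne_top ((Ideal.eq_top_iff_one _).2 (hv ▸ Ideal.mul_mem_left _ v (hPtle huP)))
  refine ⟨Pt.fractions U, hPt.fractions hdisj, hPth.fractions hU, ?_, ?_⟩
  · rintro x ⟨u, hu, p, hp, h⟩
    obtain ⟨v, hv⟩ := hunit u hu
    have hx : x * Subalgebra.inclusion hle u = Subalgebra.inclusion hle p := Subtype.ext h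
    have : x = v * Subalgebra.inclusion hle p := by linear_combination v * hx - x * hv
    rw [this]
    exact Ideal.mul_mem_left _ _ (hPtle hp)
  · rw [← hPtc]
    ext r
    refine ⟨fun hr => hPt.mem_of_mem_fractions hdisj hr, fun hr => ?_⟩
    exact ⟨1, one_mem U, algebraMap R S r, hr, by simp⟩

variable {M : Ideal S}

theorem IsGrMaxIdealOver.units_spec (hS : IsGradedOverring 𝒜 S) (hM : IsGrMaxIdealOver 𝒜 S M) :
    ∀ u ∈ hM.units hS, IsHomFrac 𝒜 (u : K) ∧ (u : K) ≠ 0 :=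
  fun u hu => ⟨hu.1, fun h0 => hu.2 (by rw [Subtype.ext (a2 := (0 : S)) h0]; exact zero_mem M)⟩

/-- The homogeneous localization at a graded maximal ideal is gr-local. -/
theorem IsGrMaxIdealOver.grLocalOver_fractions (hS : IsGradedOverring 𝒜 S)
    (hM : IsGrMaxIdealOver 𝒜 S M) : GrLocalOver 𝒜 (S.fractions (hM.units hS)) := by
  have hU := hM.units_spec hS
  have hNhom := hM.1.fractions hU
  have hN1 : M.fractions (hM.units hS) ≠ ⊤ := by
    intro htop
    obtain ⟨u, hu, s, hs, h⟩ := (Ideal.eq_top_iff_one _).1 htop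
    have : u = s := Subtype.ext (by simpa using h)
    exact hu.2 (this ▸ hs)
  have hmax : ∀ J : Ideal (S.fractions (hM.units hS)), IsHomIdealOver 𝒜 _ J → J ≠ ⊤ →
      J ≤ M.fractions (hM.units hS) := by
    intro J hJ hJ1 x hx
    suffices h : ∀ y : K, y ∈ AddSubmonoid.closure {y : K | IsHomFrac 𝒜 y ∧
        ∃ h : y ∈ S.fractions (hM.units hS), (⟨y, h⟩ : S.fractions (hM.units hS)) ∈ J} →
        y ∈ (M.fractions (hM.units hS)).toAddSubmonoid.map (S.fractions (hM.units hS)).val by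
      obtain ⟨z, hz, hzx⟩ := h x (hJ x hx)
      rwa [← Subtype.ext (a1 := z) (a2 := x) hzx]
    intro y hy
    refine (AddSubmonoid.closure_le.2 ?_) hy
    rintro y ⟨hyh, hyT, hyJ⟩
    refine ⟨⟨y, hyT⟩, ?_, rfl⟩
    obtain ⟨u, hu, hyu⟩ := id hyT
    refine ⟨u, hu, ⟨_, hyu⟩, ?_, rfl⟩
    by_contra hnot
    have hs : (⟨_, hyu⟩ : S) ∈ hM.units hS := ⟨hyh.mul hu.1, hnot⟩
    have hs0 : y * u ≠ 0 := (hU _ hs).2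
    apply hJ1
    rw [Ideal.eq_top_iff_one]
    have hv : (u : K) * (y * u)⁻¹ ∈ S.fractions (hM.units hS) :=
      ⟨_, hs, by rw [inv_mul_cancel_right₀ hs0]; exact u.2⟩
    convert Ideal.mul_mem_left J ⟨_, hv⟩ hyJ
    apply Subtype.ext
    change 1 = (u : K) * (y * u)⁻¹ * y
    rw [mul_right_comm, mul_comm (u : K), mul_inv_cancel₀ hs0]
  refine ⟨_, ⟨hNhom, hN1, fun J hJ hle hJ1 => le_antisymm (hmax J hJ hJ1) hle⟩, fun I hI => ?_⟩
  exact (hI.2.2 _ hNhom (hmax I hI.1 hI.2.1) hN1).symm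

/-- Over a graded perinormal domain, graded overrings with graded going-down are flat. -/
theorem GradedPerinormal.flat (hR : GradedPerinormal 𝒜) (hS : IsGradedOverring 𝒜 S)
    (hgd : GGD 𝒜 S) : Module.Flat R S := by
  refine flat_of_map_denominators S ?_
  rintro ⟨x, hx⟩
  change (denominators x).map (algebraMap R S) = ⊤
  replace hx := hS x hx
  induction hx using AddSubmonoid.closure_induction with
  | mem x hx =>
    by_contra hne
    have hhom : IsHomIdealOver 𝒜 S ((denominators x).map (algebraMap R S)) := by
      rw [hx.2.map_denominators S]
      exact isHomIdealOver_span hS fun a ha => ha.1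
    obtain ⟨M, hM, hle⟩ := exists_le_isGrMaxIdealOver hhom hne
    have hU := hM.units_spec hS
    obtain ⟨W, hW, hfrac⟩ := hR _ (hS.fractions hU) (hM.grLocalOver_fractions hS)
      (hgd.fractions hS hU)
    obtain ⟨r, w, hw, hr⟩ := hfrac ⟨x, S.le_fractions _ hx.1⟩
    have hwM : algebraMap R S w ∈ M := by
      refine hle (Ideal.mem_map_of_mem _ ⟨r, ?_⟩)
      rw [mul_comm]
      exact congrArg Subtype.val hr
    obtain ⟨⟨y, u, hu, hyu⟩, hy⟩ := (hW w hw).exists_right_inv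
    have hy' : algebraMap R K w * y = 1 := congrArg Subtype.val hy
    apply hu.2
    have : u = algebraMap R S w * ⟨_, hyu⟩ := by
      apply Subtype.ext
      change (u : K) = algebraMap R K w * (y * u)
      rw [← mul_assoc, hy', one_mul]
    rw [this]
    exact Ideal.mul_mem_right _ _ hwM
  | zero =>
    rw [Ideal.eq_top_iff_one, ← map_one (algebraMap R S)]
    exact Ideal.mem_map_of_mem _ ⟨0, by simp⟩
  | add x y _ _ ihx ihy =>
    rw [eq_top_iff]
    refine le_trans ?_ (Ideal.map_mono (denominators_mul_le_add x y))
    rw [Ideal.map_mul, ihx, ihy, Ideal.top_mul]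

end GradedOverrings

/-- Let `R` be a `G`-graded domain. Then `R` is a graded perinormal domain if
and only if every graded overring of `R` that satisfies graded going-down is flat as an
`R`-module. -/
theorem gradedPerinormal_iff_ggd_flat
    {G : Type*} [DecidableEq G] [AddCommGroup G] (hG : ∀ g : G, g ≠ 0 → ¬IsOfFinAddOrder g)
    {R : Type*} [CommRing R] [IsDomain R]
    (𝒜 : G → AddSubgroup R) (hGr : IsGrRing 𝒜) :
    GradedPerinormal 𝒜 ↔
      ∀ S : Subalgebra R (FractionRing R), IsGradedOverring 𝒜 S → GGD 𝒜 S →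
        Module.Flat R S := by
  let := hGr.gradedRing
  refine ⟨fun hR S hS hgd => hR.flat hS hgd, fun h S hS hloc hgd => ?_⟩
  have := h S hS hgd
  exact isLocalizationOfR_of_flat hS hloc
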